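/- arXiv:2604.18433 — 2 statements merged into one kernel-verified Lean document; each statement's English description precedes it below -/
import Mathlib

section
/- Let p be an odd prime. The commutator subgroup of the group GL₂(ℤ_p) of invertible 2×2 matrices over the p-adic integers is exactly SL₂(ℤ_p); equivalently, the commutator subgroup of GL₂(ℤ_p) equals the kernel of the determinant homomorphism det : GL₂(ℤ_p) → ℤ_pˣ. -/
open scoped MatrixGroups

lemma mem_commutator_of_mul_eq {G : Type*} [Group G] {g h k : G}
    (hk : g * h = k * h * g) :
    k ∈ commutator G := by
  have : k = g * h * g⁻¹ * h⁻¹ := by rw [hk]; group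
  rw [this, ← commutatorElement_def]
  exact Subgroup.commutator_mem_commutator (Subgroup.mem_top g) (Subgroup.mem_top h)

namespace Matrix.GeneralLinearGroup

section CommRing

variable {R : Type*} [CommRing R]

/-- The upper triangular elementary matrix with off-diagonal entry `x`. -/
noncomputable def upperElementary (x : R) : GL (Fin 2) R :=
  mk'' !![1, x; 0, 1] (by simp)

/-- The lower triangular elementary matrix with off-diagonal entry `x`. -/
noncomputable def lowerElementary (x : R) : GL (Fin 2) R :=
  mk'' !![1, 0; x, 1] (by simp)

@[simp]
lemma coe_upperElementary (x : R) :
    (upperElementary x : Matrix (Fin 2) (Fin 2) R) = !![1, x; 0, 1] := rfl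

@[simp]
lemma coe_lowerElementary (x : R) :
    (lowerElementary x : Matrix (Fin 2) (Fin 2) R) = !![1, 0; x, 1] := rfl

lemma upperElementary_mem_commutator (h2 : IsUnit (2 : R)) (x : R) :
    upperElementary x ∈ commutator (GL (Fin 2) R) := by
  refine mem_commutator_of_mul_eq (g := mk'' !![2, 0; 0, 1] (by simpa using h2))
    (h := upperElementary x) (Units.ext ?_)
  change !![2, 0; 0, 1] * !![1, x; 0, 1] = !![1, x; 0, 1] * !![1, x; 0, 1] * !![2, 0; 0, 1]
  simp [two_mul]

lemma lowerElementary_mem_commutator (h2 : IsUnit (2 : R)) (x : R) :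
    lowerElementary x ∈ commutator (GL (Fin 2) R) := by
  refine mem_commutator_of_mul_eq (g := mk'' !![1, 0; 0, 2] (by simpa using h2))
    (h := lowerElementary x) (Units.ext ?_)
  change !![1, 0; 0, 2] * !![1, 0; x, 1] = !![1, 0; x, 1] * !![1, 0; x, 1] * !![1, 0; 0, 2]
  simp [two_mul]

lemma eq_upper_mul_lower_mul_upper {A : GL (Fin 2) R} (hA : (A : Matrix (Fin 2) (Fin 2) R).det = 1)
    {v : R} (hv : A 1 0 * v = 1) :
    A = upperElementary ((A 0 0 - 1) * v) * lowerElementary (A 1 0) *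
      upperElementary ((A 1 1 - 1) * v) := by
  rw [det_fin_two] at hA
  ext i j
  fin_cases i <;> fin_cases j <;> simp <;> grind

lemma mem_commutator_of_isUnit {A : GL (Fin 2) R} (h2 : IsUnit (2 : R))
    (hA : (A : Matrix (Fin 2) (Fin 2) R).det = 1) (hc : IsUnit (A 1 0)) :
    A ∈ commutator (GL (Fin 2) R) := by
  obtain ⟨v, hv⟩ := hc.exists_right_inv
  rw [eq_upper_mul_lower_mul_upper hA hv]
  exact mul_mem (mul_mem (upperElementary_mem_commutator h2 _)
    (lowerElementary_mem_commutator h2 _)) (upperElementary_mem_commutator h2 _)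

end CommRing

theorem commutator_fin_two_eq_ker_det {R : Type*} [CommRing R] [IsLocalRing R]
    (h2 : IsUnit (2 : R)) :
    commutator (GL (Fin 2) R) = (det : GL (Fin 2) R →* Rˣ).ker := by
  refine le_antisymm (Abelianization.commutator_subset_ker _) fun A hA ↦ ?_
  have hdet : (A : Matrix (Fin 2) (Fin 2) R).det = 1 := congrArg Units.val hA
  by_cases hc : IsUnit (A 1 0)
  · exact mem_commutator_of_isUnit h2 hdet hc
  have ha : IsUnit (A 0 0 + A 1 0) := by
    by_contra h
    have ha' : A 0 0 ∈ nonunits R := by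
      simpa using IsLocalRing.nonunits_add h (b := -A 1 0) (by simpa using hc)
    rw [det_fin_two] at hdet
    have := IsLocalRing.nonunits_add (mul_mem_nonunits_left (b := A 1 1) ha')
      (mul_mem_nonunits_right (a := -A 0 1) hc)
    exact this (by rw [neg_mul, ← sub_eq_add_neg, hdet]; exact isUnit_one)
  rw [← mul_mem_cancel_left (lowerElementary_mem_commutator h2 1)]
  refine mem_commutator_of_isUnit h2 ?_ ?_
  · rw [Units.val_mul, det_mul, hdet, coe_lowerElementary]
    simp
  · simpa [Matrix.mul_apply] using ha

end Matrix.GeneralLinearGroup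

lemma PadicInt.isUnit_two {p : ℕ} [Fact p.Prime] (hp : Odd p) : IsUnit (2 : ℤ_[p]) := by
  rw [PadicInt.isUnit_iff]
  exact_mod_cast PadicInt.norm_natCast_eq_one_iff.2 hp.coprime_two_right

/-- For an odd prime `p`, the commutator subgroup of `GL₂(ℤ_p)` is exactly `SL₂(ℤ_p)`,
i.e. the kernel of the determinant homomorphism `det : GL₂(ℤ_p) → ℤ_pˣ`. -/
theorem commutator_GL2_padicInt_eq_ker_det (p : ℕ) [Fact p.Prime] (hp : Odd p) :
    commutator (GL (Fin 2) ℤ_[p]) =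
      (Matrix.GeneralLinearGroup.det : GL (Fin 2) ℤ_[p] →* ℤ_[p]ˣ).ker :=
  Matrix.GeneralLinearGroup.commutator_fin_two_eq_ker_det (PadicInt.isUnit_two hp)
end

section
/- Let p be an odd prime and let A be a commutative group. Then precomposition with the determinant homomorphism det : GL₂(ℤ_p) → ℤ_pˣ gives a bijection from the set of group homomorphisms ℤ_pˣ → A onto the set of group homomorphisms GL₂(ℤ_p) → A. In other words, every group homomorphism GL₂(ℤ_p) → A factors uniquely through det. -/
open scoped MatrixGroups

namespace Matrix.GeneralLinearGroup

variable {R : Type*} [CommRing R]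

/-- The upper unitriangular matrix with upper right entry `b`, as an element of `GL₂(R)`. -/
noncomputable def upperUnipotent (b : R) : GL (Fin 2) R :=
  mk'' !![1, b; 0, 1] (by simp [det_fin_two])

/-- The lower unitriangular matrix with lower left entry `c`, as an element of `GL₂(R)`. -/
noncomputable def lowerUnipotent (c : R) : GL (Fin 2) R :=
  mk'' !![1, 0; c, 1] (by simp [det_fin_two])

/-- The matrix exchanging the two coordinates, as an element of `GL₂(R)`. -/
noncomputable def coordSwap : GL (Fin 2) R :=
  mk'' !![0, 1; 1, 0] (by simp [det_fin_two])

/-- The homomorphism `u ↦ diag(u, 1)` from `Rˣ` to `GL₂(R)`. -/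
noncomputable def diagLeft : Rˣ →* GL (Fin 2) R where
  toFun u := mk'' !![(u : R), 0; 0, 1] (by simp [det_fin_two])
  map_one' := by
    ext i j; fin_cases i <;> fin_cases j <;> simp [mk'', nonsingInvUnit]
  map_mul' u v := by
    ext i j; fin_cases i <;> fin_cases j <;> simp [mk'', nonsingInvUnit]

/-- The homomorphism `u ↦ diag(1, u)` from `Rˣ` to `GL₂(R)`. -/
noncomputable def diagRight : Rˣ →* GL (Fin 2) R where
  toFun u := mk'' !![1, 0; 0, (u : R)] (by simp [det_fin_two])
  map_one' := by
    ext i j; fin_cases i <;> fin_cases j <;> simp [mk'', nonsingInvUnit]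
  map_mul' u v := by
    ext i j; fin_cases i <;> fin_cases j <;> simp [mk'', nonsingInvUnit]

@[simp] lemma coe_upperUnipotent (b : R) :
    (upperUnipotent b : Matrix (Fin 2) (Fin 2) R) = !![1, b; 0, 1] := rfl

@[simp] lemma coe_lowerUnipotent (c : R) :
    (lowerUnipotent c : Matrix (Fin 2) (Fin 2) R) = !![1, 0; c, 1] := rfl

@[simp] lemma coe_coordSwap :
    ((coordSwap : GL (Fin 2) R) : Matrix (Fin 2) (Fin 2) R) = !![0, 1; 1, 0] := rfl

@[simp] lemma coe_diagLeft (u : Rˣ) :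
    (diagLeft u : Matrix (Fin 2) (Fin 2) R) = !![(u : R), 0; 0, 1] := rfl

@[simp] lemma coe_diagRight (u : Rˣ) :
    (diagRight u : Matrix (Fin 2) (Fin 2) R) = !![1, 0; 0, (u : R)] := rfl

lemma det_diagRight (u : Rˣ) : det (diagRight u) = u := by
  ext; simp [det_fin_two]

lemma det_upperUnipotent (b : R) : det (upperUnipotent b) = 1 := by
  ext; simp [det_fin_two]

variable {A : Type*} [CommGroup A] (φ : GL (Fin 2) R →* A)

lemma map_upperUnipotent_eq_one (h2 : IsUnit (2 : R)) (b : R) : φ (upperUnipotent b) = 1 := by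
  obtain ⟨t, ht⟩ := h2
  have h : diagLeft t * upperUnipotent b = upperUnipotent b * upperUnipotent b * diagLeft t := by
    ext i j; fin_cases i <;> fin_cases j <;> simp [ht, two_mul]
  simpa [mul_comm (φ (diagLeft t))] using congrArg φ h

lemma map_lowerUnipotent_eq_one (h2 : IsUnit (2 : R)) (c : R) : φ (lowerUnipotent c) = 1 := by
  obtain ⟨t, ht⟩ := h2
  have h : diagRight t * lowerUnipotent c =
      lowerUnipotent c * lowerUnipotent c * diagRight t := by
    ext i j; fin_cases i <;> fin_cases j <;> simp [ht, two_mul]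
  simpa [mul_comm (φ (diagRight t))] using congrArg φ h

lemma map_diagLeft (u : Rˣ) : φ (diagLeft u) = φ (diagRight u) := by
  have h : (coordSwap : GL (Fin 2) R) * diagLeft u = diagRight u * coordSwap := by
    ext i j; fin_cases i <;> fin_cases j <;> simp
  simpa [mul_comm (φ coordSwap)] using congrArg φ h

lemma map_eq_map_diagRight_det_of_isUnit (h2 : IsUnit (2 : R)) (g : GL (Fin 2) R)
    (hg : IsUnit (g 0 0)) : φ g = φ (diagRight (det g)) := by
  obtain ⟨a, ha⟩ := hg
  obtain ⟨d, hd⟩ : ∃ d, a⁻¹ * det g = d := ⟨_, rfl⟩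
  have hdet : (d : R) = ↑a⁻¹ * (a * g 1 1 - g 0 1 * g 1 0) := by
    rw [← hd, ha, ← det_fin_two]
    rfl
  have h : g = lowerUnipotent (g 1 0 * ↑a⁻¹) * (diagLeft a * diagRight d) *
      upperUnipotent (↑a⁻¹ * g 0 1) := by
    apply Units.ext
    simp only [Units.val_mul, coe_lowerUnipotent, coe_diagLeft, coe_diagRight,
      coe_upperUnipotent, mul_fin_two]
    ext i j
    fin_cases i <;> fin_cases j
    · simp [ha]
    · simp
    · simp
    · simp [hdet]
      linear_combination -g 1 1 * a.inv_mul
  conv_lhs => rw [h]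
  simp only [map_mul, map_lowerUnipotent_eq_one φ h2, map_upperUnipotent_eq_one φ h2,
    map_diagLeft, one_mul, mul_one]
  rw [← map_mul, ← map_mul, ← hd, mul_inv_cancel_left]

/-- Over a local ring in which `2` is invertible, every homomorphism from `GL₂` to a commutative
group depends only on the determinant. -/
lemma map_eq_map_diagRight_det [IsLocalRing R] (h2 : IsUnit (2 : R)) (g : GL (Fin 2) R) :
    φ g = φ (diagRight (det g)) := by
  by_cases ha : IsUnit (g 0 0)
  · exact map_eq_map_diagRight_det_of_isUnit φ h2 g ha
  have hdet : IsUnit (g 0 0 * g 1 1 + -(g 0 1 * g 1 0)) := by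
    rw [← sub_eq_add_neg, ← det_fin_two]
    exact (det g).isUnit
  have hc : IsUnit (g 1 0) := by
    rcases IsLocalRing.isUnit_or_isUnit_of_isUnit_add hdet with h | h
    · exact absurd (isUnit_of_mul_isUnit_left h) ha
    · exact isUnit_of_mul_isUnit_right (IsUnit.neg_iff _ |>.mp h)
  have hac : IsUnit ((upperUnipotent 1 * g : GL (Fin 2) R) 0 0) := by
    have h : (upperUnipotent 1 * g : GL (Fin 2) R) 0 0 = g 0 0 + g 1 0 := by
      simp [Matrix.mul_apply]
    rw [h]
    by_contra hn
    refine IsLocalRing.nonunits_add hn ((IsUnit.neg_iff _).not.mpr ha) ?_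
    simpa using hc
  simpa [map_upperUnipotent_eq_one φ h2, det_upperUnipotent] using
    map_eq_map_diagRight_det_of_isUnit φ h2 (upperUnipotent 1 * g) hac

/-- Over a local ring in which `2` is invertible, every homomorphism from `GL₂` to a commutative
group factors uniquely through the determinant. -/
theorem bijective_comp_det [IsLocalRing R] (h2 : IsUnit (2 : R)) :
    Function.Bijective
      (fun f : Rˣ →* A => f.comp (det : GL (Fin 2) R →* Rˣ)) := by
  refine ⟨fun f₁ f₂ h => ?_, fun φ => ⟨φ.comp diagRight, ?_⟩⟩
  · ext u
    simpa only [MonoidHom.comp_apply, det_diagRight] using DFunLike.congr_fun h (diagRight u)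
  · ext g
    exact (map_eq_map_diagRight_det φ h2 g).symm

end Matrix.GeneralLinearGroup

/-- For an odd prime `p` and a commutative group `A`, precomposition with the determinant
homomorphism `det : GL₂(ℤ_p) → ℤ_pˣ` is a bijection from group homomorphisms `ℤ_pˣ → A`
onto group homomorphisms `GL₂(ℤ_p) → A`: every homomorphism `GL₂(ℤ_p) → A` factors
uniquely through `det`. -/
theorem bijective_comp_det_GL2_padicInt (p : ℕ) [Fact p.Prime] (hp : Odd p)
    (A : Type*) [CommGroup A] :
    Function.Bijective
      (fun f : ℤ_[p]ˣ →* A =>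
        f.comp (Matrix.GeneralLinearGroup.det : GL (Fin 2) ℤ_[p] →* ℤ_[p]ˣ)) := by
  exact Matrix.GeneralLinearGroup.bijective_comp_det (PadicInt.isUnit_two hp)
end
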